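/- The satisfiability problem for ATL_sc with memoryless-strategy quantification over (general, not necessarily turn-based) concurrent game structures is undecidable; this follows because the known undecidability proof for ATL_sc satisfiability over concurrent games uses only one-step games (formulas involving only one X modality), over which memoryless and general strategies coincide. -/

import Mathlib

/-!
# ATL with strategy contexts and memoryless strategies (ATL_sc^0)

Players and atomic propositions are coded as natural numbers.
-/

/-- A concurrent game structure: states labelled with atomic propositions (coded as
naturals), players coded as naturals, and a transition function assigning to each state
and each tuple of moves (one move per player) a successor state. -/
structure CGS : Type 1 where
  State : Type
  Move : Type
  move_nonempty : Nonempty Move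
  label : State → ℕ → Prop
  trans : State → (ℕ → Move) → State

/-- Player `p` controls state `s`: the successor from `s` only depends on `p`'s move. -/
def Controls (G : CGS) (p : ℕ) (s : G.State) : Prop :=
  ∀ mv mv' : ℕ → G.Move, mv p = mv' p → G.trans s mv = G.trans s mv'

/-- A game structure is turn-based if every state is controlled by a single player. -/
def TurnBased (G : CGS) : Prop := ∀ s : G.State, ∃ p : ℕ, Controls G p s

/-- A (memoryless) strategy context: a partial assignment of memoryless strategies
(functions from states to moves) to players. -/
def Ctx (G : CGS) : Type := ℕ → Option (G.State → G.Move)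

/-- The empty strategy context. -/
def emptyCtx (G : CGS) : Ctx G := fun _ => none

/-- `π` is an outcome from state `s` compatible with the memoryless context `ctx`:
at each step, every player to whom `ctx` assigns a strategy plays according to it. -/
def IsOutcome (G : CGS) (ctx : Ctx G) (s : G.State) (π : ℕ → G.State) : Prop :=
  π 0 = s ∧ ∀ i : ℕ, ∃ mv : ℕ → G.Move,
    (∀ p σ, ctx p = some σ → mv p = σ (π i)) ∧ π (i + 1) = G.trans (π i) mv

/-- Formulas of ATL_sc^0 (with LTL path modalities `X` and `U`); coalitions are
finite lists of players. -/
inductive Formula : Type where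
  | atom : ℕ → Formula
  | neg : Formula → Formula
  | conj : Formula → Formula → Formula
  | next : Formula → Formula
  | untl : Formula → Formula → Formula
  | strat : List ℕ → Formula → Formula

/-- Satisfaction of a formula on a path, under a memoryless strategy context.
`strat A φ` (the quantifier `⟨A⟩φ`) assigns new memoryless strategies to the players
of `A`, keeps the strategies of the other players from the current context, and
requires `φ` on all outcomes compatible with the resulting context. -/
def sat (G : CGS) : Formula → Ctx G → (ℕ → G.State) → Prop
  | .atom p, _, π => G.label (π 0) p
  | .neg φ, ctx, π => ¬ sat G φ ctx π
  | .conj φ ψ, ctx, π => sat G φ ctx π ∧ sat G ψ ctx π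
  | .next φ, ctx, π => sat G φ ctx (fun n => π (n + 1))
  | .untl φ ψ, ctx, π => ∃ j : ℕ, sat G ψ ctx (fun n => π (n + j)) ∧
      ∀ k < j, sat G φ ctx (fun n => π (n + k))
  | .strat A φ, ctx, π => ∃ ctx' : Ctx G,
      (∀ p, p ∉ A → ctx' p = ctx p) ∧
      (∀ p, p ∈ A → ∃ σ, ctx' p = some σ) ∧
      ∀ π' : ℕ → G.State, IsOutcome G ctx' (π 0) π' → sat G φ ctx' π'

/-- A state satisfies a formula (under a given context) if the formula holds on all
outcomes from that state compatible with the context. -/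
def StateSatCtx (G : CGS) (ctx : Ctx G) (s : G.State) (φ : Formula) : Prop :=
  ∀ π : ℕ → G.State, IsOutcome G ctx s π → sat G φ ctx π

/-- A state satisfies a formula under the empty strategy context. -/
def StateSat (G : CGS) (s : G.State) (φ : Formula) : Prop :=
  StateSatCtx G (emptyCtx G) s φ

/-- Satisfiability of an ATL_sc^0 formula in a turn-based game structure. -/
def SatTB (φ : Formula) : Prop :=
  ∃ G : CGS, TurnBased G ∧ ∃ s : G.State, StateSat G s φ

/-- An explicit injective encoding of formulas as natural numbers. -/
def encodeF : Formula → ℕ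
  | .atom n => Nat.pair 0 n
  | .neg φ => Nat.pair 1 (encodeF φ)
  | .conj φ ψ => Nat.pair 2 (Nat.pair (encodeF φ) (encodeF ψ))
  | .next φ => Nat.pair 3 (encodeF φ)
  | .untl φ ψ => Nat.pair 4 (Nat.pair (encodeF φ) (encodeF ψ))
  | .strat A φ => Nat.pair 5 (Nat.pair (Encodable.encode A) (encodeF φ))


/-- Memoryless-strategy satisfiability over arbitrary (not necessarily turn-based)
concurrent game structures. -/
def SatML (φ : Formula) : Prop := ∃ G : CGS, ∃ s : G.State, StateSat G s φ

/-! ## General (history-based) strategies -/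

/-- A general strategy context: a partial assignment of history-based strategies
(functions from finite histories, i.e. non-empty lists of visited states, to moves)
to players. -/
def GenCtx (G : CGS) : Type := ℕ → Option (List G.State → G.Move)

/-- The finite history (list of visited states) after `i` steps of a play. -/
def histUpTo (G : CGS) (π : ℕ → G.State) (i : ℕ) : List G.State :=
  (List.range (i + 1)).map π

/-- `π` is an outcome from state `s` compatible with the general strategy context
`ctx`: at each step, every player to whom `ctx` assigns a strategy plays the move
prescribed by it on the history so far. -/
def IsOutcomeGen (G : CGS) (ctx : GenCtx G) (s : G.State) (π : ℕ → G.State) : Prop :=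
  π 0 = s ∧ ∀ i : ℕ, ∃ mv : ℕ → G.Move,
    (∀ p σ, ctx p = some σ → mv p = σ (histUpTo G π i)) ∧
    π (i + 1) = G.trans (π i) mv

/-- Satisfaction with general (history-based) strategy quantification: `⟨A⟩φ` assigns
new general strategies to the players of `A`, keeps the strategies of the other
players from the current context, and requires `φ` on all compatible outcomes. -/
def satGen (G : CGS) : Formula → GenCtx G → (ℕ → G.State) → Prop
  | .atom p, _, π => G.label (π 0) p
  | .neg φ, ctx, π => ¬ satGen G φ ctx π
  | .conj φ ψ, ctx, π => satGen G φ ctx π ∧ satGen G ψ ctx π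
  | .next φ, ctx, π => satGen G φ ctx (fun n => π (n + 1))
  | .untl φ ψ, ctx, π => ∃ j : ℕ, satGen G ψ ctx (fun n => π (n + j)) ∧
      ∀ k < j, satGen G φ ctx (fun n => π (n + k))
  | .strat A φ, ctx, π => ∃ ctx' : GenCtx G,
      (∀ p, p ∉ A → ctx' p = ctx p) ∧
      (∀ p, p ∈ A → ∃ σ, ctx' p = some σ) ∧
      ∀ π' : ℕ → G.State, IsOutcomeGen G ctx' (π 0) π' → satGen G φ ctx' π'

/-- State satisfaction with general strategies, under the empty context. -/
def StateSatGen (G : CGS) (s : G.State) (φ : Formula) : Prop :=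
  ∀ π : ℕ → G.State, IsOutcomeGen G (fun _ => none) s π → satGen G φ (fun _ => none) π

/-- Formulas with no temporal modality at all. -/
def XFree : Formula → Prop
  | .atom _ => True
  | .neg φ => XFree φ
  | .conj φ ψ => XFree φ ∧ XFree ψ
  | .next _ => False
  | .untl _ _ => False
  | .strat _ φ => XFree φ

/-- One-step formulas: they involve only one `X` modality (no nesting of `X`) and
no `U` modality. -/
def OneStep : Formula → Prop
  | .atom _ => True
  | .neg φ => OneStep φ
  | .conj φ ψ => OneStep φ ∧ OneStep ψ
  | .next φ => XFree φ
  | .untl _ _ => False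
  | .strat _ φ => OneStep φ

namespace ATLsc

/-! ## Outcomes and one-step formulas -/

theorem exists_compatible_move {G : CGS} (ctx : Ctx G) (s : G.State) :
    ∃ mv : ℕ → G.Move, ∀ p σ, ctx p = some σ → mv p = σ s := by
  obtain ⟨d⟩ := G.move_nonempty
  refine ⟨fun p => ((ctx p).map fun σ => σ s).getD d, fun p σ h => ?_⟩
  simp [h]

theorem exists_outcome_of_move {G : CGS} (ctx : Ctx G) (s : G.State) (mv : ℕ → G.Move)
    (h : ∀ p σ, ctx p = some σ → mv p = σ s) :
    ∃ π, IsOutcome G ctx s π ∧ π 1 = G.trans s mv := by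
  choose c hc using exists_compatible_move ctx
  refine ⟨fun n => Nat.casesOn n s fun k => (fun t => G.trans t (c t))^[k] (G.trans s mv),
    ⟨rfl, fun i => ?_⟩, rfl⟩
  cases i with
  | zero => exact ⟨mv, h, rfl⟩
  | succ k => exact ⟨c _, hc _, Function.iterate_succ_apply' _ _ _⟩

theorem exists_outcome {G : CGS} (ctx : Ctx G) (s : G.State) : ∃ π, IsOutcome G ctx s π := by
  obtain ⟨mv, h⟩ := exists_compatible_move ctx s
  obtain ⟨π, hπ, -⟩ := exists_outcome_of_move ctx s mv h
  exact ⟨π, hπ⟩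

theorem exists_play_of_history_choice (G : CGS) (s : G.State)
    (c : List G.State → ℕ → G.Move) :
    ∃ π : ℕ → G.State, π 0 = s ∧ ∀ i, π (i + 1) = G.trans (π i) (c (histUpTo G π i)) := by
  let step : List G.State × G.State → List G.State × G.State := fun x =>
    (x.1 ++ [G.trans x.2 (c x.1)], G.trans x.2 (c x.1))
  let H : ℕ → List G.State × G.State := fun n => step^[n] ([s], s)
  have hH : ∀ n, H (n + 1) = step (H n) := fun n => Function.iterate_succ_apply' _ _ _
  have hist : ∀ n, histUpTo G (fun n => (H n).2) n = (H n).1 := by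
    intro n
    induction n with
    | zero => simp [histUpTo, H]
    | succ n ih =>
      have : histUpTo G (fun n => (H n).2) (n + 1)
          = histUpTo G (fun n => (H n).2) n ++ [(H (n + 1)).2] := by
        simp [histUpTo, List.range_succ]
      rw [this, ih, hH]
  refine ⟨fun n => (H n).2, rfl, fun i => ?_⟩
  rw [hist]
  simp only [hH]
  rfl

theorem histUpTo_zero (G : CGS) (π : ℕ → G.State) : histUpTo G π 0 = [π 0] := by
  simp [histUpTo]

theorem exists_outcomeGen_of_move {G : CGS} (ctx : GenCtx G) (s : G.State)
    (mv : ℕ → G.Move) (h : ∀ p σ, ctx p = some σ → mv p = σ [s]) :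
    ∃ π, IsOutcomeGen G ctx s π ∧ π 1 = G.trans s mv := by
  classical
  obtain ⟨d⟩ := G.move_nonempty
  obtain ⟨π, h0, hπ⟩ := exists_play_of_history_choice G s fun l p =>
    if l = [s] then mv p else ((ctx p).map fun σ => σ l).getD d
  refine ⟨π, ⟨h0, fun i => ⟨_, fun p σ hσ => ?_, hπ i⟩⟩, ?_⟩
  · split_ifs with hl
    · rw [hl, h p σ hσ]
    · simp [hσ]
  · rw [hπ 0, histUpTo_zero, h0]
    simp

theorem exists_outcomeGen {G : CGS} (ctx : GenCtx G) (s : G.State) :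
    ∃ π, IsOutcomeGen G ctx s π := by
  obtain ⟨d⟩ := G.move_nonempty
  obtain ⟨π, hπ, -⟩ := exists_outcomeGen_of_move ctx s
    (fun p => ((ctx p).map fun σ => σ [s]).getD d) fun p σ h => by simp [h]
  exact ⟨π, hπ⟩

/-- A formula without temporal modalities only depends on the current state. -/
theorem satGen_iff_sat_of_xFree {G : CGS} {φ : Formula} (hφ : XFree φ) :
    ∀ {gctx : GenCtx G} {ctx : Ctx G} {π π' : ℕ → G.State}, π 0 = π' 0 →
      (satGen G φ gctx π ↔ sat G φ ctx π') := by
  obtain ⟨d⟩ := G.move_nonempty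
  induction φ with
  | atom p => intro gctx ctx π π' h; simp [sat, satGen, h]
  | neg φ ih => intro gctx ctx π π' h; exact not_congr (ih hφ h)
  | conj φ ψ ihφ ihψ =>
    intro gctx ctx π π' h
    simp only [sat, satGen]
    exact and_congr (ihφ hφ.1 h) (ihψ hφ.2 h)
  | next φ => exact hφ.elim
  | untl φ ψ => exact hφ.elim
  | strat A φ ih =>
    intro gctx ctx π π' h
    classical
    constructor
    · rintro ⟨gctx', -, -, H⟩
      obtain ⟨ρ, hρ⟩ := exists_outcomeGen gctx' (π 0)
      refine ⟨fun p => if p ∈ A then some fun _ => d else ctx p, fun p hp => by simp [hp],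
        fun p hp => ⟨fun _ => d, by simp [hp]⟩, fun ρ' hρ' => ?_⟩
      exact (ih hφ (by rw [hρ.1, hρ'.1, h])).1 (H ρ hρ)
    · rintro ⟨ctx', -, -, H⟩
      obtain ⟨ρ, hρ⟩ := exists_outcome ctx' (π' 0)
      refine ⟨fun p => if p ∈ A then some fun _ => d else gctx p, fun p hp => by simp [hp],
        fun p hp => ⟨fun _ => d, by simp [hp]⟩, fun ρ' hρ' => ?_⟩
      exact (ih hφ (by rw [hρ.1, hρ'.1, h])).2 (H ρ hρ)

/-- A general and a memoryless context prescribe the same first moves from `s`. -/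
def AgreeAt {G : CGS} (s : G.State) (gctx : GenCtx G) (ctx : Ctx G) : Prop :=
  ∀ p, (gctx p).map (fun σ => σ [s]) = (ctx p).map (fun σ => σ s)

theorem AgreeAt.gen_of_some {G : CGS} {s : G.State} {gctx : GenCtx G} {ctx : Ctx G}
    (h : AgreeAt s gctx ctx) {p : ℕ} {σ : G.State → G.Move} (hσ : ctx p = some σ) :
    ∃ τ, gctx p = some τ ∧ τ [s] = σ s := by
  have := h p
  rw [hσ] at this
  simpa using this

theorem AgreeAt.of_some {G : CGS} {s : G.State} {gctx : GenCtx G} {ctx : Ctx G}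
    (h : AgreeAt s gctx ctx) {p : ℕ} {τ : List G.State → G.Move} (hτ : gctx p = some τ) :
    ∃ σ, ctx p = some σ ∧ σ s = τ [s] := by
  have := h p
  rw [hτ] at this
  simpa using this.symm

theorem AgreeAt.exists_outcomeGen {G : CGS} {s : G.State} {gctx : GenCtx G} {ctx : Ctx G}
    (h : AgreeAt s gctx ctx) {π : ℕ → G.State} (hπ : IsOutcome G ctx s π) :
    ∃ π', IsOutcomeGen G gctx s π' ∧ π' 0 = π 0 ∧ π' 1 = π 1 := by
  obtain ⟨mv, hmv, h1⟩ := hπ.2 0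
  rw [hπ.1] at h1 hmv
  obtain ⟨π', hπ', h1'⟩ := exists_outcomeGen_of_move gctx s mv fun p τ hτ => by
    obtain ⟨σ, hσ, e⟩ := h.of_some hτ
    rw [hmv p σ hσ, e]
  exact ⟨π', hπ', by rw [hπ'.1, hπ.1], by rw [h1', h1]⟩

theorem AgreeAt.exists_outcome {G : CGS} {s : G.State} {gctx : GenCtx G} {ctx : Ctx G}
    (h : AgreeAt s gctx ctx) {π : ℕ → G.State} (hπ : IsOutcomeGen G gctx s π) :
    ∃ π', IsOutcome G ctx s π' ∧ π 0 = π' 0 ∧ π 1 = π' 1 := by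
  obtain ⟨mv, hmv, h1⟩ := hπ.2 0
  rw [histUpTo_zero, hπ.1] at hmv
  rw [hπ.1] at h1
  obtain ⟨π', hπ', h1'⟩ := exists_outcome_of_move ctx s mv fun p σ hσ => by
    obtain ⟨τ, hτ, e⟩ := h.gen_of_some hσ
    rw [hmv p τ hτ, e]
  exact ⟨π', hπ', by rw [hπ'.1, hπ.1], by rw [h1', h1]⟩

theorem satGen_iff_sat_of_oneStep {G : CGS} {φ : Formula} (hφ : OneStep φ) :
    ∀ {gctx : GenCtx G} {ctx : Ctx G} {π π' : ℕ → G.State}, AgreeAt (π 0) gctx ctx →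
      π 0 = π' 0 → π 1 = π' 1 → (satGen G φ gctx π ↔ sat G φ ctx π') := by
  induction φ with
  | atom p => intro gctx ctx π π' _ h _; simp [sat, satGen, h]
  | neg φ ih => intro gctx ctx π π' ha h h1; exact not_congr (ih hφ ha h h1)
  | conj φ ψ ihφ ihψ =>
    intro gctx ctx π π' ha h h1
    simp only [sat, satGen]
    exact and_congr (ihφ hφ.1 ha h h1) (ihψ hφ.2 ha h h1)
  | next φ => intro gctx ctx π π' _ _ h1; exact satGen_iff_sat_of_xFree hφ h1
  | untl φ ψ => exact hφ.elim
  | strat A φ ih =>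
    intro gctx ctx π π' ha h _
    classical
    constructor
    · rintro ⟨gctx', hA, hA', H⟩
      have hag : AgreeAt (π 0) gctx' fun p =>
          if p ∈ A then (gctx' p).map fun τ _ => τ [π 0] else ctx p := by
        intro p
        by_cases hp : p ∈ A
        · simp [hp, Function.comp_def]
        · simpa [hp, hA p hp] using ha p
      refine ⟨fun p => if p ∈ A then (gctx' p).map fun τ _ => τ [π 0] else ctx p,
        fun p hp => ?_, fun p hp => ?_, fun ρ hρ => ?_⟩
      · exact if_neg hp
      · obtain ⟨τ, hτ⟩ := hA' p hp
        exact ⟨fun _ => τ [π 0], by simp [hp, hτ]⟩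
      · rw [← h] at hρ
        obtain ⟨ρ', hρ', e0, e1⟩ := hag.exists_outcomeGen hρ
        exact (ih hφ (by rw [hρ'.1]; exact hag) e0 e1).1 (H ρ' hρ')
    · rintro ⟨ctx', hA, hA', H⟩
      have hag : AgreeAt (π 0)
          (fun p => if p ∈ A then (ctx' p).map fun σ _ => σ (π 0) else gctx p) ctx' := by
        intro p
        by_cases hp : p ∈ A
        · simp [hp, Function.comp_def]
        · simpa [hp, hA p hp] using ha p
      refine ⟨fun p => if p ∈ A then (ctx' p).map fun σ _ => σ (π 0) else gctx p,
        fun p hp => ?_, fun p hp => ?_, fun ρ hρ => ?_⟩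
      · exact if_neg hp
      · obtain ⟨σ, hσ⟩ := hA' p hp
        exact ⟨fun _ => σ (π 0), by simp [hp, hσ]⟩
      · obtain ⟨ρ', hρ', e0, e1⟩ := hag.exists_outcome hρ
        rw [h] at hρ'
        exact (ih hφ (by rw [hρ.1]; exact hag) e0 e1).2 (H ρ' hρ')

theorem stateSatGen_iff_stateSat_of_oneStep (G : CGS) (s : G.State) {φ : Formula}
    (hφ : OneStep φ) : StateSatGen G s φ ↔ StateSat G s φ := by
  have hag : AgreeAt s (fun _ => none) (emptyCtx G) := fun _ => rfl
  constructor
  · intro H π hπ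
    obtain ⟨π', hπ', e0, e1⟩ := hag.exists_outcomeGen hπ
    exact (satGen_iff_sat_of_oneStep hφ (by rw [hπ'.1]; exact hag) e0 e1).1 (H π' hπ')
  · intro H π hπ
    obtain ⟨π', hπ', e0, e1⟩ := hag.exists_outcome hπ
    exact (satGen_iff_sat_of_oneStep hφ (by rw [hπ.1]; exact hag) e0 e1).2 (H π' hπ')

/-! ## First-order logic inside one-step games -/

/-- First-order formulas with five variables over ternary relation symbols. -/
inductive FO : Type where
  | rel : ℕ → Fin 5 → Fin 5 → Fin 5 → FO
  | neg : FO → FO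
  | conj : FO → FO → FO
  | ex : Fin 5 → FO → FO

/-- Truth of a first-order formula under a valuation. -/
def FO.eval {D : Type} (ρ : ℕ → D → D → D → Prop) : FO → (Fin 5 → D) → Prop
  | .rel r i j l, v => ρ r (v i) (v j) (v l)
  | .neg φ, v => ¬ φ.eval ρ v
  | .conj φ ψ, v => φ.eval ρ v ∧ ψ.eval ρ v
  | .ex i φ, v => ∃ d, φ.eval ρ (Function.update v i d)

/-- On plays from `s`, in contexts whose domain is the set of the players below `8`, the
formula `φ` expresses the property `Q` of the tuple of moves prescribed at `s`. -/
def Means (G : CGS) (s : G.State) (φ : Formula) (Q : (ℕ → G.Move) → Prop) : Prop :=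
  ∀ (ctx : Ctx G) (π : ℕ → G.State) (m : ℕ → G.Move), π 0 = s →
    (∀ p, 8 ≤ p → ctx p = none) → (∀ p < 8, ∃ σ, ctx p = some σ ∧ σ s = m p) →
    (sat G φ ctx π ↔ Q m)

section Means

variable {G : CGS} {s : G.State} {φ ψ : Formula} {Q R : (ℕ → G.Move) → Prop}

theorem Means.neg (h : Means G s φ Q) : Means G s φ.neg fun m => ¬ Q m :=
  fun ctx π m h0 hn hs => not_congr (h ctx π m h0 hn hs)

theorem Means.conj (h : Means G s φ Q) (h' : Means G s ψ R) :
    Means G s (φ.conj ψ) fun m => Q m ∧ R m :=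
  fun ctx π m h0 hn hs => and_congr (h ctx π m h0 hn hs) (h' ctx π m h0 hn hs)

theorem Means.congr (h : Means G s φ Q) (e : ∀ m, Q m ↔ R m) : Means G s φ R :=
  fun ctx π m h0 hn hs => (h ctx π m h0 hn hs).trans (e m)

theorem Means.sat_strat_iff (h : Means G s φ Q) {A : List ℕ} (hA : ∀ p ∈ A, p < 8)
    {ctx : Ctx G} {π : ℕ → G.State} {m : ℕ → G.Move} (h0 : π 0 = s)
    (hn : ∀ p, 8 ≤ p → ctx p = none)
    (hs : ∀ p < 8, p ∉ A → ∃ σ, ctx p = some σ ∧ σ s = m p) :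
    sat G (.strat A φ) ctx π ↔ ∃ m', (∀ p, p ∉ A → m' p = m p) ∧ Q m' := by
  classical
  constructor
  · rintro ⟨ctx', hA₁, hA₂, H⟩
    obtain ⟨π', hπ'⟩ := exists_outcome ctx' s
    refine ⟨fun p => if p ∈ A then ((ctx' p).map fun σ => σ s).getD (m p) else m p,
      fun p hp => if_neg hp, ?_⟩
    refine (h ctx' π' _ hπ'.1 (fun p hp => ?_) (fun p hp => ?_)).1 (H π' (by rwa [h0]))
    · rw [hA₁ p fun hpA => absurd (hA p hpA) (by omega), hn p hp]
    · by_cases hpA : p ∈ A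
      · obtain ⟨σ, hσ⟩ := hA₂ p hpA
        exact ⟨σ, hσ, by simp [hpA, hσ]⟩
      · simpa [hpA, hA₁ p hpA] using hs p hp hpA
  · rintro ⟨m', hm', hQ⟩
    refine ⟨fun p => if p ∈ A then some fun _ => m' p else ctx p, fun p hp => if_neg hp,
      fun p hp => ⟨_, if_pos hp⟩, fun π' hπ' => ?_⟩
    refine (h _ π' m' (hπ'.1.trans h0) (fun p hp => ?_) (fun p hp => ?_)).2 hQ
    · rw [if_neg fun hpA => absurd (hA p hpA) (by omega), hn p hp]
    · by_cases hpA : p ∈ A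
      · exact ⟨_, if_pos hpA, rfl⟩
      · simpa [hpA, hm' p hpA] using hs p hp hpA

theorem Means.strat (h : Means G s φ Q) {A : List ℕ} (hA : ∀ p ∈ A, p < 8) :
    Means G s (.strat A φ) fun m => ∃ m', (∀ p, p ∉ A → m' p = m p) ∧ Q m' :=
  fun _ _ _ h0 hn hs => h.sat_strat_iff hA h0 hn fun p hp _ => hs p hp

/-- The dual of the strategy quantifier. -/
def stratAll (A : List ℕ) (φ : Formula) : Formula := .neg (.strat A (.neg φ))

theorem Means.stratAll (h : Means G s φ Q) {A : List ℕ} (hA : ∀ p ∈ A, p < 8) :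
    Means G s (stratAll A φ) fun m => ∀ m', (∀ p, p ∉ A → m' p = m p) → Q m' :=
  (h.neg.strat hA).neg.congr fun m => by simp

/-- Implication. -/
def fimp (φ ψ : Formula) : Formula := .neg (.conj φ (.neg ψ))

theorem Means.fimp (h : Means G s φ Q) (h' : Means G s ψ R) :
    Means G s (fimp φ ψ) fun m => Q m → R m :=
  (h.conj h'.neg).neg.congr fun m => by simp

/-- All outcomes satisfy the atom `a` after one step. -/
def nextAtom (a : ℕ) : Formula := .strat [] (.next (.atom a))

theorem means_nextAtom (a : ℕ) : Means G s (nextAtom a) fun m =>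
    ∀ mv, (∀ p < 8, mv p = m p) → G.label (G.trans s mv) a := by
  intro ctx π m h0 hn hs
  constructor
  · rintro ⟨ctx', hctx', -, H⟩ mv hmv
    have hc : ctx' = ctx := funext fun p => hctx' p (by simp)
    subst hc
    obtain ⟨π', hπ', h1⟩ := exists_outcome_of_move ctx' s mv fun p σ hσ => by
      by_cases hp : p < 8
      · obtain ⟨τ, hτ, e⟩ := hs p hp
        rw [hσ] at hτ
        cases hτ
        rw [hmv p hp, e]
      · rw [hn p (by omega)] at hσ
        cases hσ
    have := H π' (by rwa [h0])
    rwa [← h1]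
  · intro H
    refine ⟨ctx, fun _ _ => rfl, by simp, fun π' hπ' => ?_⟩
    obtain ⟨mv, hmv, h1⟩ := hπ'.2 0
    rw [hπ'.1, h0] at h1 hmv
    change G.label (π' 1) a
    rw [h1]
    refine H mv fun p hp => ?_
    obtain ⟨σ, hσ, e⟩ := hs p hp
    rw [hmv p σ hσ, e]

/-- The atom `a` holds after one step whatever is played by the players outside `S`. -/
def lit (S : List ℕ) (a : ℕ) : Formula :=
  stratAll ((List.range 8).filter fun p => p ∉ S) (nextAtom a)

theorem means_lit {S : List ℕ} (hS : ∀ p ∈ S, p < 8) (a : ℕ) : Means G s (lit S a) fun m =>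
    ∀ mv, (∀ p ∈ S, mv p = m p) → G.label (G.trans s mv) a := by
  classical
  refine ((means_nextAtom a).stratAll (by simp +contextual)).congr fun m => ?_
  constructor
  · intro H mv hmv
    refine H (fun p => if p < 8 ∧ p ∉ S then mv p else m p) (fun p hp => ?_) mv fun p hp => ?_
    · exact if_neg (by simpa using hp)
    · by_cases hpS : p ∈ S
      · simp [hpS, hmv p hpS]
      · simp [hp, hpS]
  · intro H m' hm' mv hmv
    refine H mv fun p hp => ?_
    rw [hmv p (hS p hp), hm' p (by simp [hp])]

end Means

/-- Variable `i` and register `t` are related. -/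
def link (i : Fin 5) (t : Fin 3) : Formula := lit [i + 3, t] (3 * i + t)

/-- The registers satisfy the relation `r`. -/
def reg (r : ℕ) : Formula := lit [0, 1, 2] (r + 15)

/-- Translation of first-order formulas: the value of variable `i` is the move of player
`i + 3`, and players `0`, `1`, `2` serve as registers for the arguments of relations. -/
def FO.toFormula : FO → Formula
  | .rel r i j l => stratAll [0, 1, 2]
      (fimp (link i 0) (fimp (link j 1) (fimp (link l 2) (reg r))))
  | .neg φ => .neg φ.toFormula
  | .conj φ ψ => .conj φ.toFormula ψ.toFormula
  | .ex i φ => .strat [i + 3] φ.toFormula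

/-- Move `a` of the player of variable `i` is linked with move `x` of register `t`. -/
def Linked (G : CGS) (s : G.State) (i : Fin 5) (t : Fin 3) (a x : G.Move) : Prop :=
  ∀ mv : ℕ → G.Move, mv (i + 3) = a → mv t = x → G.label (G.trans s mv) (3 * i + t)

/-- The relation `r` between the moves of the registers. -/
def RegRel (G : CGS) (s : G.State) (r : ℕ) (x y z : G.Move) : Prop :=
  ∀ mv : ℕ → G.Move, mv 0 = x → mv 1 = y → mv 2 = z → G.label (G.trans s mv) (r + 15)

theorem means_link {G : CGS} {s : G.State} (i : Fin 5) (t : Fin 3) :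
    Means G s (link i t) fun m => Linked G s i t (m (i + 3)) (m t) :=
  (means_lit (by simp; omega) _).congr fun m => by simp [Linked]

theorem means_reg {G : CGS} {s : G.State} (r : ℕ) :
    Means G s (reg r) fun m => RegRel G s r (m 0) (m 1) (m 2) :=
  (means_lit (by simp) _).congr fun m => by simp [RegRel]

theorem means_toFormula_rel {G : CGS} {s : G.State} (r : ℕ) (i j l : Fin 5) :
    Means G s (FO.rel r i j l).toFormula fun m => ∀ x y z,
      Linked G s i 0 (m (i + 3)) x → Linked G s j 1 (m (j + 3)) y →
      Linked G s l 2 (m (l + 3)) z → RegRel G s r x y z := by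
  refine (((means_link i 0).fimp ((means_link j 1).fimp ((means_link l 2).fimp
    (means_reg r)))).stratAll (by simp)).congr fun m => ?_
  constructor
  · intro H x y z
    simpa using H (fun p => if p = 0 then x else if p = 1 then y else if p = 2 then z else m p)
      (by simp +contextual)
  · intro H m' hm'
    have h := H (m' 0) (m' 1) (m' 2)
    rw [← hm' _ (by simp), ← hm' _ (by simp), ← hm' _ (by simp)] at h
    exact h

/-- If the moves of all variable players name, surjectively, the elements of `D`, then the
translation of `φ` expresses the truth of `φ` in `D`. -/
theorem means_toFormula {G : CGS} {s : G.State} {D : Type} {ρ : ℕ → D → D → D → Prop}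
    {val : Fin 5 → G.Move → D} (hval : ∀ i, Function.Surjective (val i))
    (hρ : ∀ r i j l a b c, (∀ x y z, Linked G s i 0 a x → Linked G s j 1 b y →
      Linked G s l 2 c z → RegRel G s r x y z) ↔ ρ r (val i a) (val j b) (val l c))
    (φ : FO) :
    Means G s φ.toFormula fun m => φ.eval ρ fun i => val i (m (i + 3)) := by
  induction φ with
  | rel r i j l => exact (means_toFormula_rel r i j l).congr fun m => hρ _ _ _ _ _ _ _
  | neg φ ih => exact ih.neg
  | conj φ ψ ihφ ihψ => exact ihφ.conj ihψ
  | ex i φ ih =>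
    refine (ih.strat (by simp; omega)).congr fun m => ?_
    have key : ∀ m' : ℕ → G.Move, (∀ p, p ∉ [(i : ℕ) + 3] → m' p = m p) →
        (fun j : Fin 5 => val j (m' (j + 3)))
          = Function.update (fun j : Fin 5 => val j (m (j + 3))) i (val i (m' (i + 3))) := by
      intro m' hm'
      funext j
      by_cases hj : j = i
      · subst hj; simp
      · rw [Function.update_of_ne hj, hm' _ (by simpa [Fin.ext_iff] using hj)]
    constructor
    · rintro ⟨m', hm', H⟩
      rw [key m' hm'] at H
      exact ⟨_, H⟩
    · rintro ⟨d, H⟩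
      obtain ⟨a, rfl⟩ := hval i d
      refine ⟨Function.update m (i + 3) a, fun p hp => ?_, ?_⟩
      · exact Function.update_of_ne (by simpa using hp) _ _
      · rw [key _ fun p hp => Function.update_of_ne (by simpa using hp) _ _]
        simpa using H

/-- Every value of variable `i` is also a value of variable `j`. -/
def copy (i j : Fin 5) : Formula :=
  stratAll [i + 3] (.strat [j + 3] (stratAll [0, 1, 2]
    (.conj (.conj (fimp (link i 0) (link j 0)) (fimp (link j 0) (link i 0)))
      (.conj (.conj (fimp (link i 1) (link j 1)) (fimp (link j 1) (link i 1)))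
        (.conj (fimp (link i 2) (link j 2)) (fimp (link j 2) (link i 2)))))))

theorem means_copy {G : CGS} {s : G.State} {i j : Fin 5} (hij : i ≠ j) :
    Means G s (copy i j) fun _ => ∀ a, ∃ b, ∀ t x, Linked G s i t a x ↔ Linked G s j t b x := by
  have L := fun (i j : Fin 5) t =>
    (means_link (G := G) (s := s) i t).fimp (means_link (G := G) (s := s) j t)
  have hij' : (i : ℕ) ≠ j := fun h => hij (Fin.ext h)
  refine ((((((L i j 0).conj (L j i 0)).conj (((L i j 1).conj (L j i 1)).conj
    ((L i j 2).conj (L j i 2)))).stratAll (by simp)).strat (by simp; omega)).stratAll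
    (by simp; omega)).congr fun m => ?_
  constructor
  · intro H a
    obtain ⟨m', hm', H'⟩ := H (Function.update m (i + 3) a)
      fun p hp => Function.update_of_ne (by simpa using hp) _ _
    have hi : m' (i + 3) = a := by rw [hm' _ (by simpa using hij')]; simp
    refine ⟨m' (j + 3), fun t x => ?_⟩
    have h := H' (fun p => if p < 3 then x else m' p) fun p hp => by
      rw [if_neg (by simp at hp; omega)]
    fin_cases t <;> simp [hi] at h ⊢ <;> tauto
  · intro H m₁ hm₁
    obtain ⟨b, hb⟩ := H (m₁ (i + 3))
    refine ⟨Function.update m₁ (j + 3) b,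
      fun p hp => Function.update_of_ne (by simpa using hp) _ _, fun m₂ hm₂ => ?_⟩
    have hi : m₂ (i + 3) = m₁ (i + 3) := by
      rw [hm₂ _ (by simp), Function.update_of_ne (by omega)]
    have hj : m₂ (j + 3) = b := by rw [hm₂ _ (by simp)]; simp
    simp [hi, hj, hb]

/-- All variables have the same values. -/
def copies : Formula :=
  ((List.finRange 5 ×ˢ List.finRange 5).filter fun q => q.1 ≠ q.2).foldr
    (fun q φ => .conj (copy q.1 q.2) φ) (fimp (copy 0 1) (copy 0 1))

theorem means_copies {G : CGS} {s : G.State} : Means G s copies fun _ =>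
    ∀ i j a, ∃ b, ∀ t x, Linked G s i t a x ↔ Linked G s j t b x := by
  have key : ∀ L : List (Fin 5 × Fin 5), (∀ q ∈ L, q.1 ≠ q.2) →
      Means G s (L.foldr (fun q φ => .conj (copy q.1 q.2) φ) (fimp (copy 0 1) (copy 0 1)))
        fun _ => ∀ q ∈ L, ∀ a, ∃ b, ∀ t x, Linked G s q.1 t a x ↔ Linked G s q.2 t b x := by
    intro L hL
    induction L with
    | nil =>
      exact ((means_copy (by decide)).fimp (means_copy (by decide))).congr fun m => by simp
    | cons q L ih =>
      refine ((means_copy (hL q (by simp))).conj (ih fun q hq => hL q (by simp [hq]))).congr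
        fun m => ?_
      rw [List.forall_mem_cons]
  refine (key _ (by simp)).congr fun m => ⟨fun H i j => ?_, fun H q _ => H q.1 q.2⟩
  by_cases hij : i = j
  · subst hij
    exact fun a => ⟨a, fun _ _ => Iff.rfl⟩
  · exact H (i, j) (by simp [hij])

theorem Means.stateSat_strat_iff {G : CGS} {s : G.State} {φ : Formula}
    {Q : (ℕ → G.Move) → Prop} (h : Means G s φ Q) :
    StateSat G s (.strat (List.range 8) φ) ↔ ∃ m, Q m := by
  obtain ⟨d⟩ := G.move_nonempty
  have hiff : ∀ (m : ℕ → G.Move) (π : ℕ → G.State), π 0 = s →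
      (sat G (.strat (List.range 8) φ) (emptyCtx G) π ↔
        ∃ m', (∀ p, p ∉ List.range 8 → m' p = m p) ∧ Q m') := fun m π h0 =>
    h.sat_strat_iff (by simp) h0 (fun _ _ => rfl)
      fun p hp hp' => absurd (List.mem_range.2 hp) hp'
  constructor
  · intro H
    obtain ⟨π, hπ⟩ := exists_outcome (emptyCtx G) s
    obtain ⟨m, -, hm⟩ := (hiff (fun _ => d) π hπ.1).1 (H π hπ)
    exact ⟨m, hm⟩
  · rintro ⟨m, hm⟩ π hπ
    exact (hiff m π hπ.1).2 ⟨m, fun _ _ => rfl, hm⟩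

theorem exists_means_toFormula (G : CGS) (s : G.State) (φ : FO) :
    ∃ Q, Means G s φ.toFormula Q := by
  induction φ with
  | rel r i j l => exact ⟨_, means_toFormula_rel r i j l⟩
  | neg φ ih => exact ⟨_, ih.choose_spec.neg⟩
  | conj φ ψ ihφ ihψ => exact ⟨_, ihφ.choose_spec.conj ihψ.choose_spec⟩
  | ex i φ ih => exact ⟨_, ih.choose_spec.strat (by simp; omega)⟩

/-- The translation of first-order satisfiability into satisfiability in games. -/
def game (φ : FO) : Formula := .strat (List.range 8) (.conj copies φ.toFormula)

theorem satML_game_iff (φ : FO) : SatML (game φ) ↔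
    ∃ (D : Type) (ρ : ℕ → D → D → D → Prop) (v : Fin 5 → D), φ.eval ρ v := by
  constructor
  · rintro ⟨G, s, H⟩
    have hcopy : ∀ i j a, ∃ b, ∀ t x, Linked G s i t a x ↔ Linked G s j t b x := by
      obtain ⟨Q, hQ⟩ := exists_means_toFormula G s φ
      obtain ⟨m, hm, -⟩ := (means_copies.conj hQ).stateSat_strat_iff.1 H
      exact hm
    let name : Fin 5 → G.Move → Fin 3 → G.Move → Prop := fun i a t x => Linked G s i t a x
    have hname : ∀ i j a, ∃ b, name j b = name i a := fun i j a => by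
      obtain ⟨b, hb⟩ := hcopy i j a
      exact ⟨b, funext fun t => funext fun x => propext (hb t x).symm⟩
    let val : Fin 5 → G.Move → Set.range (name 0) := fun i a => ⟨name i a, hname i 0 a⟩
    let ρ : ℕ → Set.range (name 0) → Set.range (name 0) → Set.range (name 0) → Prop :=
      fun r A B C => ∀ x y z, A.1 0 x → B.1 1 y → C.1 2 z → RegRel G s r x y z
    have hval : ∀ i, Function.Surjective (val i) := by
      rintro i ⟨_, a, rfl⟩
      obtain ⟨b, hb⟩ := hname 0 i a
      exact ⟨b, Subtype.ext hb⟩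
    have hφ := means_toFormula (ρ := ρ) hval (fun r i j l a b c => Iff.rfl) φ
    obtain ⟨m, -, hm⟩ := (means_copies.conj hφ).stateSat_strat_iff.1 H
    exact ⟨_, ρ, _, hm⟩
  · rintro ⟨D, ρ, v, H⟩
    let G : CGS :=
      { State := ℕ → D
        Move := D
        move_nonempty := ⟨v 0⟩
        label := fun mv a => (∃ (i : Fin 5) (t : Fin 3), a = 3 * i + t ∧ mv (i + 3) = mv t) ∨
          ∃ r, a = r + 15 ∧ ρ r (mv 0) (mv 1) (mv 2)
        trans := fun _ mv => mv }
    let s : G.State := fun _ => v 0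
    have hlink : ∀ (i : Fin 5) (t : Fin 3) (a x : D), Linked G s i t a x ↔ a = x := by
      intro i t a x
      constructor
      · intro h
        have h' := h (fun p => if p = i + 3 then a else x) (by simp)
          (if_neg (by omega))
        rcases h' with ⟨i', t', e, h'⟩ | ⟨r, e, -⟩
        · obtain rfl : i' = i := by omega
          obtain rfl : t' = t := by omega
          dsimp only [G] at h'
          rwa [if_pos rfl, if_neg (by omega)] at h'
        · omega
      · rintro rfl mv h₁ h₂
        exact Or.inl ⟨i, t, rfl, h₁.trans h₂.symm⟩
    have hreg : ∀ (r : ℕ) (x y z : D), RegRel G s r x y z ↔ ρ r x y z := by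
      intro r x y z
      constructor
      · intro h
        have h' := h (fun p => if p = 0 then x else if p = 1 then y else z) rfl rfl rfl
        rcases h' with ⟨i', t', e, -⟩ | ⟨r', e, h'⟩
        · omega
        · obtain rfl : r = r' := by omega
          exact h'
      · rintro h mv rfl rfl rfl
        exact Or.inr ⟨r, rfl, h⟩
    have hφ := means_toFormula (G := G) (s := s) (ρ := ρ) (val := fun _ a => a)
      (fun _ => Function.surjective_id)
      (fun r i j l a b c => by simp only [hlink, hreg]; exact
        ⟨fun h => h a b c rfl rfl rfl, by rintro h _ _ _ rfl rfl rfl; exact h⟩) φ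
    refine ⟨G, s, (means_copies.conj hφ).stateSat_strat_iff.2
      ⟨fun p => if h : p - 3 < 5 then v ⟨p - 3, h⟩ else v 0, fun i j a => ⟨a, fun t x => ?_⟩, ?_⟩⟩
    · rw [hlink, hlink]
    · simpa using H

/-! ## Undecidability of first-order satisfiability -/

open Turing.ToPartrec

/-- Universal quantification. -/
def FO.all (i : Fin 5) (φ : FO) : FO := .neg (.ex i (.neg φ))

/-- Implication. -/
def FO.imp (φ ψ : FO) : FO := .neg (.conj φ (.neg ψ))

/-- Universal closure. -/
def FO.closure (φ : FO) : FO := .all 0 (.all 1 (.all 2 (.all 3 (.all 4 φ))))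

/-- The closure of the implication from the conjunction of `body` to `head`. -/
def FO.clause (body : List FO) (head : FO) : FO := (body.foldr FO.imp head).closure

/-- The conjunction of a list of formulas with a further formula. -/
def FO.conjList (L : List FO) (φ : FO) : FO := L.foldr FO.conj φ

section FO

variable {D : Type} {ρ : ℕ → D → D → D → Prop} {v : Fin 5 → D}

theorem FO.eval_all {i : Fin 5} {φ : FO} :
    (FO.all i φ).eval ρ v ↔ ∀ d, φ.eval ρ (Function.update v i d) := by
  simp [FO.all, FO.eval]

theorem FO.eval_imp {φ ψ : FO} : (φ.imp ψ).eval ρ v ↔ (φ.eval ρ v → ψ.eval ρ v) := by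
  simp [FO.imp, FO.eval]

theorem FO.eval_closure {φ : FO} :
    φ.closure.eval ρ v ↔ ∀ x y z t u, φ.eval ρ ![x, y, z, t, u] := by
  have key : ∀ x y z t u, Function.update (Function.update (Function.update (Function.update
      (Function.update v 0 x) 1 y) 2 z) 3 t) 4 u = ![x, y, z, t, u] := by
    intro x y z t u
    funext i
    fin_cases i <;> simp [Function.update]
  simp only [FO.closure, FO.eval_all, key]

theorem FO.eval_clause {body : List FO} {head : FO} : (FO.clause body head).eval ρ v ↔
    ∀ x y z t u, (∀ φ ∈ body, φ.eval ρ ![x, y, z, t, u]) → head.eval ρ ![x, y, z, t, u] := by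
  have key : ∀ w, (body.foldr FO.imp head).eval ρ w ↔
      ((∀ φ ∈ body, φ.eval ρ w) → head.eval ρ w) := by
    intro w
    induction body with
    | nil => simp
    | cons φ L ih => simp [FO.eval_imp, ih]
  simp only [FO.clause, FO.eval_closure, key]

theorem FO.eval_conjList {L : List FO} {φ : FO} :
    (FO.conjList L φ).eval ρ v ↔ (∀ ψ ∈ L, ψ.eval ρ v) ∧ φ.eval ρ v := by
  unfold FO.conjList
  induction L with
  | nil => simp
  | cons ψ L ih => simp [FO.eval, ih, and_assoc]

end FO

/-- An injective numbering of the codes of list functions. -/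
def codeIndex : Code → ℕ
  | .zero' => Nat.pair 0 0
  | .succ => Nat.pair 1 0
  | .tail => Nat.pair 2 0
  | .cons f g => Nat.pair 3 (Nat.pair (codeIndex f) (codeIndex g))
  | .comp f g => Nat.pair 4 (Nat.pair (codeIndex f) (codeIndex g))
  | .case f g => Nat.pair 5 (Nat.pair (codeIndex f) (codeIndex g))
  | .fix f => Nat.pair 6 (codeIndex f)

theorem codeIndex_injective : Function.Injective codeIndex := by
  intro c
  induction c with
  | zero' => intro d h; cases d <;> simp [codeIndex] at h ⊢
  | succ => intro d h; cases d <;> simp [codeIndex] at h ⊢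
  | tail => intro d h; cases d <;> simp [codeIndex] at h ⊢
  | cons f g hf hg =>
    intro d h
    cases d <;> simp [codeIndex] at h ⊢
    exact ⟨hf h.1, hg h.2⟩
  | comp f g hf hg =>
    intro d h
    cases d <;> simp [codeIndex] at h ⊢
    exact ⟨hf h.1, hg h.2⟩
  | case f g hf hg =>
    intro d h
    cases d <;> simp [codeIndex] at h ⊢
    exact ⟨hf h.1, hg h.2⟩
  | fix f hf =>
    intro d h
    cases d <;> simp [codeIndex] at h ⊢
    exact hf h

/-- `i` is the empty list. -/
def isNil (i : Fin 5) : FO := .rel 0 i i i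

/-- `j` is `i` with a zero put in front. -/
def isPush (i j : Fin 5) : FO := .rel 1 i j j

/-- `j` is `i` with its head incremented. -/
def isInc (i j : Fin 5) : FO := .rel 2 i j j

/-- `j` is the tail of `i`. -/
def isTail (i j : Fin 5) : FO := .rel 3 i j j

/-- `l` is `j` with the head of `i` put in front. -/
def isCons (i j l : Fin 5) : FO := .rel 4 i j l

/-- `j` is the value of the code `c` at `i`. -/
def isEval (c : Code) (i j : Fin 5) : FO := .rel (codeIndex c + 5) i j j

/-- Axioms for the list operations. -/
def listAxioms : List FO :=
  [.ex 0 (isNil 0),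
    .closure (.ex 1 (isPush 0 1)),
    .closure (.imp (isPush 0 1) (.ex 2 (isInc 1 2))),
    .closure (.imp (isInc 0 1) (.ex 2 (isInc 1 2))),
    .clause [isNil 0] (isTail 0 0),
    .clause [isPush 1 0] (isTail 0 1),
    .clause [isTail 0 1, isInc 0 2] (isTail 2 1),
    .clause [isNil 0, isPush 3 4] (isCons 0 3 4),
    .clause [isPush 1 0, isPush 3 4] (isCons 0 3 4),
    .clause [isCons 0 3 4, isInc 0 1, isInc 4 2] (isCons 1 3 2)]

/-- Axioms for the evaluation of a code and of its subcodes. -/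
def evalAxioms : Code → List FO
  | .zero' => [.clause [isPush 0 1] (isEval .zero' 0 1)]
  | .succ => [.clause [isNil 3, isCons 0 3 4, isInc 4 1] (isEval .succ 0 1)]
  | .tail => [.clause [isTail 0 1] (isEval .tail 0 1)]
  | .cons f g =>
    .clause [isEval f 0 1, isEval g 0 3, isCons 1 3 4] (isEval (.cons f g) 0 4) ::
      (evalAxioms f ++ evalAxioms g)
  | .comp f g =>
    .clause [isEval g 0 1, isEval f 1 2] (isEval (.comp f g) 0 2) ::
      (evalAxioms f ++ evalAxioms g)
  | .case f g =>
    .clause [isNil 0, isEval f 0 1] (isEval (.case f g) 0 1) ::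
    .clause [isPush 2 0, isEval f 2 1] (isEval (.case f g) 0 1) ::
    .clause [isInc 2 0, isEval g 2 1] (isEval (.case f g) 0 1) ::
      (evalAxioms f ++ evalAxioms g)
  | .fix f =>
    .clause [isEval f 0 1, isNil 1] (isEval (.fix f) 0 1) ::
    .clause [isEval f 0 1, isPush 3 1] (isEval (.fix f) 0 3) ::
    .clause [isEval f 0 1, isInc 2 1, isTail 2 3, isEval (.fix f) 3 4]
      (isEval (.fix f) 0 4) ::
      evalAxioms f

/-- The content of the axioms for the list operations. -/
structure ListModel {D : Type} (ρ : ℕ → D → D → D → Prop) : Prop where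
  exists_nil : ∃ x, ρ 0 x x x
  exists_push : ∀ x, ∃ y, ρ 1 x y y
  inc_of_push : ∀ x y, ρ 1 x y y → ∃ z, ρ 2 y z z
  inc_of_inc : ∀ x y, ρ 2 x y y → ∃ z, ρ 2 y z z
  tail_nil : ∀ x, ρ 0 x x x → ρ 3 x x x
  tail_push : ∀ x y, ρ 1 y x x → ρ 3 x y y
  tail_inc : ∀ x y z, ρ 3 x y y → ρ 2 x z z → ρ 3 z y y
  cons_nil : ∀ x t u, ρ 0 x x x → ρ 1 t u u → ρ 4 x t u
  cons_push : ∀ x y t u, ρ 1 y x x → ρ 1 t u u → ρ 4 x t u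
  cons_inc : ∀ x y z t u, ρ 4 x t u → ρ 2 x y y → ρ 2 u z z → ρ 4 y t z

theorem eval_listAxioms_iff {D : Type} {ρ : ℕ → D → D → D → Prop} {v : Fin 5 → D} :
    (∀ φ ∈ listAxioms, φ.eval ρ v) ↔ ListModel ρ := by
  simp only [listAxioms, List.forall_mem_cons, FO.eval_clause, FO.eval_closure, FO.eval_imp,
    FO.eval, isNil, isPush, isInc, isTail, isCons, List.not_mem_nil, false_imp_iff, forall_true_iff,
    and_true, and_imp]
  constructor
  · rintro ⟨h₁, h₂, h₃, h₄, h₅, h₆, h₇, h₈, h₉, h₁₀⟩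
    exact
      { exists_nil := h₁
        exists_push := fun x => h₂ x x x x x
        inc_of_push := fun x y => h₃ x y x x x
        inc_of_inc := fun x y => h₄ x y x x x
        tail_nil := fun x => h₅ x x x x x
        tail_push := fun x y => h₆ x y x x x
        tail_inc := fun x y z => h₇ x y z x x
        cons_nil := fun x t u => h₈ x x x t u
        cons_push := fun x y t u => h₉ x y x t u
        cons_inc := fun x y z t u => h₁₀ x y z t u }
  · intro h
    exact ⟨h.exists_nil, fun x _ _ _ _ => h.exists_push x, fun x y _ _ _ => h.inc_of_push x y,
      fun x y _ _ _ => h.inc_of_inc x y, fun x _ _ _ _ => h.tail_nil x,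
      fun x y _ _ _ => h.tail_push x y, fun x y z _ _ => h.tail_inc x y z,
      fun x _ _ t u => h.cons_nil x t u, fun x y _ t u => h.cons_push x y t u,
      fun x y z t u => h.cons_inc x y z t u⟩

/-! ### The standard model -/

/-- The intended interpretation of the relation symbols on lists of naturals. -/
def listRel : ℕ → List ℕ → List ℕ → List ℕ → Prop
  | 0, x, _, _ => x = []
  | 1, x, y, _ => y = 0 :: x
  | 2, x, y, _ => ∃ n l, x = n :: l ∧ y = (n + 1) :: l
  | 3, x, y, _ => y = x.tail
  | 4, x, y, z => z = x.headI :: y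
  | r + 5, x, y, _ => ∃ c, codeIndex c = r ∧ y ∈ c.eval x

theorem listRel_codeIndex {c : Code} {x y z : List ℕ} :
    listRel (codeIndex c + 5) x y z ↔ y ∈ c.eval x := by
  constructor
  · rintro ⟨d, hd, h⟩
    rwa [← codeIndex_injective hd]
  · exact fun h => ⟨c, rfl, h⟩

theorem listRel_nil {x y z : List ℕ} : listRel 0 x y z ↔ x = [] := Iff.rfl

theorem listRel_push {x y z : List ℕ} : listRel 1 x y z ↔ y = 0 :: x := Iff.rfl

theorem listRel_inc {x y z : List ℕ} :
    listRel 2 x y z ↔ ∃ n l, x = n :: l ∧ y = (n + 1) :: l := Iff.rfl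

theorem listRel_tail {x y z : List ℕ} : listRel 3 x y z ↔ y = x.tail := Iff.rfl

theorem listRel_cons {x y z : List ℕ} : listRel 4 x y z ↔ z = x.headI :: y := Iff.rfl

theorem mem_eval_zero' {x o : List ℕ} : o ∈ Code.zero'.eval x ↔ o = 0 :: x := by
  rw [Code.zero'_eval]
  exact Part.mem_some_iff

theorem mem_eval_succ {x o : List ℕ} : o ∈ Code.succ.eval x ↔ o = [x.headI + 1] := by
  rw [Code.succ_eval]
  exact Part.mem_some_iff

theorem mem_eval_tail {x o : List ℕ} : o ∈ Code.tail.eval x ↔ o = x.tail := by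
  rw [Code.tail_eval]
  exact Part.mem_some_iff

theorem mem_eval_cons {f g : Code} {x o : List ℕ} : o ∈ (Code.cons f g).eval x ↔
    ∃ y ∈ f.eval x, ∃ z ∈ g.eval x, o = y.headI :: z := by
  rw [Code.cons_eval]
  refine Part.mem_bind_iff.trans (exists_congr fun y => and_congr_right fun _ => ?_)
  exact Part.mem_bind_iff.trans (exists_congr fun z => and_congr_right fun _ =>
    Part.mem_some_iff)

theorem mem_eval_comp {f g : Code} {x o : List ℕ} : o ∈ (Code.comp f g).eval x ↔
    ∃ y ∈ g.eval x, o ∈ f.eval y := by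
  rw [Code.comp_eval]
  exact Part.mem_bind_iff

theorem eval_case_nil (f g : Code) : (Code.case f g).eval [] = f.eval [] := by
  rw [Code.case_eval]
  rfl

theorem eval_case_zero (f g : Code) (l : List ℕ) :
    (Code.case f g).eval (0 :: l) = f.eval l := by
  rw [Code.case_eval]
  rfl

theorem eval_case_succ (f g : Code) (n : ℕ) (l : List ℕ) :
    (Code.case f g).eval ((n + 1) :: l) = g.eval (n :: l) := by
  rw [Code.case_eval]
  rfl

/-- One round of the loop `Code.fix f`. -/
def fixStep (f : Code) : List ℕ →. List ℕ ⊕ List ℕ := fun x =>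
  (f.eval x).map fun y => if y.headI = 0 then Sum.inl y.tail else Sum.inr y.tail

theorem eval_fix (f : Code) : (Code.fix f).eval = (fixStep f).fix := Code.fix_eval f

theorem inl_mem_fixStep {f : Code} {x o : List ℕ} : Sum.inl o ∈ fixStep f x ↔
    ∃ y ∈ f.eval x, y.headI = 0 ∧ o = y.tail := by
  refine (Part.mem_map_iff _).trans (exists_congr fun y => and_congr_right fun _ => ?_)
  split_ifs with h <;> simp [h, eq_comm]

theorem inr_mem_fixStep {f : Code} {x o : List ℕ} : Sum.inr o ∈ fixStep f x ↔
    ∃ y ∈ f.eval x, y.headI ≠ 0 ∧ o = y.tail := by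
  refine (Part.mem_map_iff _).trans (exists_congr fun y => and_congr_right fun _ => ?_)
  split_ifs with h <;> simp [h, eq_comm]

theorem mem_eval_fix_of_zero {f : Code} {x y : List ℕ} (hy : y ∈ f.eval x)
    (h : y.headI = 0) : y.tail ∈ (Code.fix f).eval x := by
  rw [eval_fix]
  exact PFun.mem_fix_iff.2 (Or.inl (inl_mem_fixStep.2 ⟨y, hy, h, rfl⟩))

theorem mem_eval_fix_of_ne_zero {f : Code} {x y o : List ℕ} (hy : y ∈ f.eval x)
    (h : y.headI ≠ 0) (ho : o ∈ (Code.fix f).eval y.tail) : o ∈ (Code.fix f).eval x := by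
  rw [eval_fix] at *
  exact PFun.mem_fix_iff.2 (Or.inr ⟨y.tail, inr_mem_fixStep.2 ⟨y, hy, h, rfl⟩, ho⟩)

theorem listModel_listRel : ListModel listRel where
  exists_nil := ⟨[], rfl⟩
  exists_push := fun x => ⟨0 :: x, rfl⟩
  inc_of_push := by
    rintro x _ rfl
    exact ⟨_, _, _, rfl, rfl⟩
  inc_of_inc := by
    rintro _ _ ⟨n, l, rfl, rfl⟩
    exact ⟨_, _, _, rfl, rfl⟩
  tail_nil := by
    rintro _ rfl
    rfl
  tail_push := by
    rintro _ y rfl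
    rfl
  tail_inc := by
    rintro _ _ _ rfl ⟨n, l, rfl, rfl⟩
    rfl
  cons_nil := by
    rintro _ t _ rfl rfl
    rfl
  cons_push := by
    rintro _ y t _ rfl rfl
    rfl
  cons_inc := by
    rintro _ _ _ t _ rfl ⟨n, l, rfl, rfl⟩ ⟨k, l', e, rfl⟩
    cases e
    rfl

theorem eval_evalAxioms (c : Code) (v : Fin 5 → List ℕ) :
    ∀ φ ∈ evalAxioms c, φ.eval listRel v := by
  induction c with
  | zero' =>
    simp [evalAxioms, FO.eval_clause, FO.eval, isPush, isEval, listRel_codeIndex, listRel_push,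
      mem_eval_zero', -Code.zero'_eval]
  | succ =>
    simp [evalAxioms, FO.eval_clause, FO.eval, isNil, isCons, isInc, isEval, listRel_codeIndex,
      listRel_nil, listRel_cons, listRel_inc, mem_eval_succ, -Code.succ_eval]
  | tail =>
    simp [evalAxioms, FO.eval_clause, FO.eval, isTail, isEval, listRel_codeIndex, listRel_tail,
      mem_eval_tail, -Code.tail_eval]
  | cons f g hf hg =>
    simp only [evalAxioms, List.forall_mem_cons, List.forall_mem_append]
    refine ⟨?_, hf, hg⟩
    simp [FO.eval_clause, FO.eval, isCons, isEval, listRel_codeIndex, listRel_cons, mem_eval_cons,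
      -Code.cons_eval]
    exact fun x y z o hy hz ho => ⟨y, hy, z, hz, ho⟩
  | comp f g hf hg =>
    simp only [evalAxioms, List.forall_mem_cons, List.forall_mem_append]
    refine ⟨?_, hf, hg⟩
    simp [FO.eval_clause, FO.eval, isEval, listRel_codeIndex, mem_eval_comp, -Code.comp_eval]
    exact fun x y z hy hz => ⟨y, hy, hz⟩
  | case f g hf hg =>
    simp only [evalAxioms, List.forall_mem_cons, List.forall_mem_append]
    refine ⟨?_, ?_, ?_, hf, hg⟩
    · simp [FO.eval_clause, FO.eval, isNil, isEval, listRel_codeIndex, listRel_nil,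
        -Code.case_eval]
      rintro _ y rfl h
      rwa [eval_case_nil]
    · simp [FO.eval_clause, FO.eval, isPush, isEval, listRel_codeIndex, listRel_push,
        -Code.case_eval]
      rintro _ y z rfl h
      rwa [eval_case_zero]
    · simp [FO.eval_clause, FO.eval, isInc, isEval, listRel_codeIndex, listRel_inc,
        -Code.case_eval]
      rintro _ y _ n l rfl rfl h
      rwa [eval_case_succ]
  | fix f hf =>
    simp only [evalAxioms, List.forall_mem_cons]
    refine ⟨?_, ?_, ?_, hf⟩
    · simp [FO.eval_clause, FO.eval, isNil, isEval, listRel_codeIndex, listRel_nil,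
        -Code.fix_eval]
      rintro x _ h rfl
      exact mem_eval_fix_of_zero h rfl
    · simp [FO.eval_clause, FO.eval, isPush, isEval, listRel_codeIndex, listRel_push,
        -Code.fix_eval]
      rintro x _ l h rfl
      exact mem_eval_fix_of_zero h rfl
    · simp [FO.eval_clause, FO.eval, isInc, isTail, isEval, listRel_codeIndex, listRel_inc,
        listRel_tail, -Code.fix_eval]
      rintro x _ _ _ o h n l rfl rfl rfl ho
      exact mem_eval_fix_of_ne_zero h (Nat.succ_ne_zero n) ho

/-! ### Arbitrary models -/

/-- The element `x` represents the given list of naturals. -/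
inductive Rep {D : Type} (ρ : ℕ → D → D → D → Prop) : List ℕ → D → Prop
  | nil {x : D} : ρ 0 x x x → Rep ρ [] x
  | push {l : List ℕ} {x y : D} : Rep ρ l y → ρ 1 y x x → Rep ρ (0 :: l) x
  | inc {n : ℕ} {l : List ℕ} {x y : D} : Rep ρ (n :: l) y → ρ 2 y x x → Rep ρ ((n + 1) :: l) x

section Rep

variable {D : Type} {ρ : ℕ → D → D → D → Prop} {v : Fin 5 → D}

theorem ListModel.exists_inc (hρ : ListModel ρ) {n : ℕ} {l : List ℕ} {x : D}
    (h : Rep ρ (n :: l) x) : ∃ z, ρ 2 x z z := by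
  cases h with
  | push _ h => exact hρ.inc_of_push _ _ h
  | inc _ h => exact hρ.inc_of_inc _ _ h

theorem ListModel.exists_tail (hρ : ListModel ρ) {l : List ℕ} {x : D} (h : Rep ρ l x) :
    ∃ y, Rep ρ l.tail y ∧ ρ 3 x y y := by
  induction h with
  | nil h => exact ⟨_, .nil h, hρ.tail_nil _ h⟩
  | push h' h => exact ⟨_, h', hρ.tail_push _ _ h⟩
  | inc _ h ih =>
    obtain ⟨y, hy, e⟩ := ih
    exact ⟨y, hy, hρ.tail_inc _ _ _ e h⟩

theorem ListModel.exists_cons (hρ : ListModel ρ) {l k : List ℕ} {x t : D} (h : Rep ρ l x)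
    (ht : Rep ρ k t) : ∃ u, Rep ρ (l.headI :: k) u ∧ ρ 4 x t u := by
  obtain ⟨u, hu⟩ := hρ.exists_push t
  induction h with
  | nil h => exact ⟨u, .push ht hu, hρ.cons_nil _ _ _ h hu⟩
  | push h' h => exact ⟨u, .push ht hu, hρ.cons_push _ _ _ _ h hu⟩
  | inc _ h ih =>
    obtain ⟨w, hw, e⟩ := ih
    obtain ⟨z, hz⟩ := hρ.exists_inc hw
    exact ⟨z, .inc hw hz, hρ.cons_inc _ _ _ _ _ e h hz⟩

/-- In every model of the axioms, the relation of a code contains its graph. -/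
theorem ListModel.exists_eval (hρ : ListModel ρ) {c : Code}
    (hc : ∀ φ ∈ evalAxioms c, φ.eval ρ v) {l o : List ℕ} {x : D} (ho : o ∈ c.eval l)
    (hx : Rep ρ l x) : ∃ y, Rep ρ o y ∧ ρ (codeIndex c + 5) x y y := by
  induction c generalizing l o x with
  | zero' =>
    rw [mem_eval_zero'] at ho
    subst ho
    obtain ⟨y, hy⟩ := hρ.exists_push x
    have h := FO.eval_clause.1 (hc _ (by simp [evalAxioms]; rfl)) x y x x x
    exact ⟨y, .push hx hy, h (by simpa [FO.eval, isPush] using hy)⟩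
  | succ =>
    rw [mem_eval_succ] at ho
    subst ho
    obtain ⟨t, ht⟩ := hρ.exists_nil
    obtain ⟨u, hu, e⟩ := hρ.exists_cons hx (.nil ht)
    obtain ⟨y, hy⟩ := hρ.exists_inc hu
    have h := FO.eval_clause.1 (hc _ (by simp [evalAxioms]; rfl)) x y x t u
    exact ⟨y, .inc hu hy, h (by simp [FO.eval, isNil, isCons, isInc, ht, e, hy])⟩
  | tail =>
    rw [mem_eval_tail] at ho
    subst ho
    obtain ⟨y, hy, e⟩ := hρ.exists_tail hx
    have h := FO.eval_clause.1 (hc _ (by simp [evalAxioms]; rfl)) x y x x x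
    exact ⟨y, hy, h (by simpa [FO.eval, isTail] using e)⟩
  | cons f g hf hg =>
    simp only [evalAxioms, List.forall_mem_cons, List.forall_mem_append] at hc
    obtain ⟨h, hcf, hcg⟩ := hc
    obtain ⟨k, hk, k', hk', rfl⟩ := mem_eval_cons.1 ho
    obtain ⟨y, hy, ey⟩ := hf hcf hk hx
    obtain ⟨t, ht, et⟩ := hg hcg hk' hx
    obtain ⟨u, hu, eu⟩ := hρ.exists_cons hy ht
    exact ⟨u, hu, FO.eval_clause.1 h x y x t u (by simp [FO.eval, isEval, isCons, ey, et, eu])⟩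
  | comp f g hf hg =>
    simp only [evalAxioms, List.forall_mem_cons, List.forall_mem_append] at hc
    obtain ⟨h, hcf, hcg⟩ := hc
    obtain ⟨k, hk, hk'⟩ := mem_eval_comp.1 ho
    obtain ⟨y, hy, ey⟩ := hg hcg hk hx
    obtain ⟨z, hz, ez⟩ := hf hcf hk' hy
    exact ⟨z, hz, FO.eval_clause.1 h x y z x x (by simp [FO.eval, isEval, ey, ez])⟩
  | case f g hf hg =>
    simp only [evalAxioms, List.forall_mem_cons, List.forall_mem_append] at hc
    obtain ⟨h₁, h₂, h₃, hcf, hcg⟩ := hc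
    cases hx with
    | nil hn =>
      rw [eval_case_nil] at ho
      obtain ⟨y, hy, ey⟩ := hf hcf ho (.nil hn)
      exact ⟨y, hy, FO.eval_clause.1 h₁ x y x x x (by simp [FO.eval, isNil, isEval, hn, ey])⟩
    | @push _ _ w hw e =>
      rw [eval_case_zero] at ho
      obtain ⟨y, hy, ey⟩ := hf hcf ho hw
      exact ⟨y, hy, FO.eval_clause.1 h₂ x y w x x (by simp [FO.eval, isPush, isEval, e, ey])⟩
    | @inc _ _ _ w hw e =>
      rw [eval_case_succ] at ho
      obtain ⟨y, hy, ey⟩ := hg hcg ho hw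
      exact ⟨y, hy, FO.eval_clause.1 h₃ x y w x x (by simp [FO.eval, isInc, isEval, e, ey])⟩
  | fix f hf =>
    simp only [evalAxioms, List.forall_mem_cons] at hc
    obtain ⟨h₁, h₂, h₃, hcf⟩ := hc
    rw [eval_fix] at ho
    revert x
    refine PFun.fixInduction' (C := fun l => ∀ {x : D}, Rep ρ l x →
      ∃ y, Rep ρ o y ∧ ρ (codeIndex (.fix f) + 5) x y y) ho ?_ ?_
    · intro l hl x hx
      obtain ⟨k, hk, h0, rfl⟩ := inl_mem_fixStep.1 hl
      obtain ⟨y, hy, ey⟩ := hf hcf hk hx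
      cases hy with
      | nil hn =>
        exact ⟨y, .nil hn,
          FO.eval_clause.1 h₁ x y x x x (by simp [FO.eval, isNil, isEval, hn, ey])⟩
      | @push _ _ t ht e =>
        exact ⟨t, ht,
          FO.eval_clause.1 h₂ x y x t x (by simp [FO.eval, isPush, isEval, e, ey])⟩
      | inc => simp at h0
    · intro l l' _ hl ih x hx
      obtain ⟨k, hk, h0, rfl⟩ := inr_mem_fixStep.1 hl
      obtain ⟨y, hy, ey⟩ := hf hcf hk hx
      cases hy with
      | nil => exact absurd rfl h0
      | push => exact absurd rfl h0
      | @inc _ _ _ w hw e =>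
        obtain ⟨t, ht, et⟩ := hρ.exists_tail hw
        obtain ⟨u, hu, eu⟩ := ih ht
        exact ⟨u, hu, FO.eval_clause.1 h₃ x y w t u
          (by simp [FO.eval, isInc, isTail, isEval, e, ey, et, eu])⟩

end Rep

/-- The code `c` is undefined at the result of incrementing the head of variable `0` for
`2 * n` times. -/
def undefinedAfter (c : Code) : ℕ → FO
  | 0 => .neg (.ex 1 (isEval c 0 1))
  | n + 1 => .ex 1 (.conj (isInc 0 1) (.ex 0 (.conj (isInc 1 0) (undefinedAfter c n))))

/-- A sentence which is satisfiable if and only if `c` is undefined at `[2 * n]`. -/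
def undefinedAt (c : Code) (n : ℕ) : FO :=
  .conjList (listAxioms ++ evalAxioms c)
    (.ex 1 (.conj (isNil 1) (.ex 0 (.conj (isPush 1 0) (undefinedAfter c n)))))

theorem eval_undefinedAfter_listRel {c : Code} {n m : ℕ} {v : Fin 5 → List ℕ}
    (hv : v 0 = [m]) (h : ¬ (c.eval [m + 2 * n]).Dom) : (undefinedAfter c n).eval listRel v := by
  induction n generalizing m v with
  | zero =>
    rintro ⟨y, hy⟩
    refine h (Part.dom_iff_mem.2 ⟨y, ?_⟩)
    simpa [FO.eval, isEval, listRel_codeIndex, hv] using hy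
  | succ n ih =>
    refine ⟨[m + 1], ⟨m, [], hv, rfl⟩, [m + 2], ⟨m + 1, [], rfl, rfl⟩, ?_⟩
    exact ih rfl (by rwa [show m + 2 + 2 * n = m + 2 * (n + 1) by ring])

theorem not_dom_of_eval_undefinedAfter {D : Type} {ρ : ℕ → D → D → D → Prop}
    (hρ : ListModel ρ) {c : Code} {w : Fin 5 → D} (hc : ∀ φ ∈ evalAxioms c, φ.eval ρ w)
    {n m : ℕ} {v : Fin 5 → D} (hv : Rep ρ [m] (v 0)) (h : (undefinedAfter c n).eval ρ v) :
    ¬ (c.eval [m + 2 * n]).Dom := by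
  induction n generalizing m v with
  | zero =>
    intro hd
    obtain ⟨o, ho⟩ := Part.dom_iff_mem.1 hd
    obtain ⟨y, -, hy⟩ := hρ.exists_eval hc ho hv
    exact h ⟨y, by simpa [FO.eval, isEval] using hy⟩
  | succ n ih =>
    obtain ⟨x, hx, y, hy, h'⟩ := h
    rw [show m + 2 * (n + 1) = m + 2 + 2 * n by ring]
    refine ih ?_ h'
    simp only [FO.eval, isInc] at hx hy
    simp at hx hy
    simpa using Rep.inc (Rep.inc hv hx) hy

theorem undefinedAt_satisfiable_iff (c : Code) (n : ℕ) :
    (∃ (D : Type) (ρ : ℕ → D → D → D → Prop) (v : Fin 5 → D), (undefinedAt c n).eval ρ v) ↔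
      ¬ (c.eval [2 * n]).Dom := by
  constructor
  · rintro ⟨D, ρ, v, H⟩
    rw [undefinedAt, FO.eval_conjList, List.forall_mem_append, eval_listAxioms_iff] at H
    obtain ⟨⟨hρ, hc⟩, x, hx, y, hy, h⟩ := H
    simp [FO.eval, isNil, isPush] at hx hy
    rw [show 2 * n = 0 + 2 * n by ring]
    exact not_dom_of_eval_undefinedAfter hρ hc (by simpa using Rep.push (.nil hx) hy) h
  · intro h
    refine ⟨List ℕ, listRel, fun _ => [], ?_⟩
    rw [undefinedAt, FO.eval_conjList, List.forall_mem_append, eval_listAxioms_iff]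
    refine ⟨⟨listModel_listRel, eval_evalAxioms c _⟩, [], rfl, [0], rfl, ?_⟩
    exact eval_undefinedAfter_listRel rfl (by simpa using h)

/-! ## The reduction -/

theorem primrec_encodeF_conj (A : Formula) {X : ℕ → Formula}
    (h : Primrec fun n => encodeF (X n)) : Primrec fun n => encodeF (.conj A (X n)) :=
  Primrec₂.natPair.comp (Primrec.const 2) (Primrec₂.natPair.comp (Primrec.const _) h)

theorem primrec_encodeF_strat (A : List ℕ) {X : ℕ → Formula}
    (h : Primrec fun n => encodeF (X n)) : Primrec fun n => encodeF (.strat A (X n)) :=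
  Primrec₂.natPair.comp (Primrec.const 5) (Primrec₂.natPair.comp (Primrec.const _) h)

theorem primrec_encodeF_undefinedAfter (c : Code) :
    Primrec fun n => encodeF (undefinedAfter c n).toFormula := by
  let F : ℕ → ℕ := fun k =>
    Nat.pair 5 (Nat.pair (Encodable.encode [4]) (Nat.pair 2 (Nat.pair
      (encodeF (isInc 0 1).toFormula) (Nat.pair 5 (Nat.pair (Encodable.encode [3])
        (Nat.pair 2 (Nat.pair (encodeF (isInc 1 0).toFormula) k)))))))
  have hpair : ∀ (a : ℕ) {f : ℕ → ℕ}, Primrec f → Primrec fun k => Nat.pair a (f k) :=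
    fun a f hf => Primrec₂.natPair.comp (Primrec.const a) hf
  have hF : Primrec F :=
    hpair _ (hpair _ (hpair _ (hpair _ (hpair _ (hpair _ (hpair _ (hpair _ .id)))))))
  refine (Primrec.nat_rec₁ (encodeF (undefinedAfter c 0).toFormula)
    (f := fun _ k => F k) (hF.comp Primrec.snd)).of_eq fun n => ?_
  induction n with
  | zero => rfl
  | succ n ih => exact congrArg F ih

theorem primrec_encodeF_game_undefinedAt (c : Code) :
    Primrec fun n => encodeF (game (undefinedAt c n)) := by
  have hL : ∀ (L : List FO) {X : ℕ → FO}, (Primrec fun n => encodeF (X n).toFormula) →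
      Primrec fun n => encodeF (FO.conjList L (X n)).toFormula := by
    intro L X hX
    induction L with
    | nil => exact hX
    | cons φ L ih => exact primrec_encodeF_conj φ.toFormula ih
  refine primrec_encodeF_strat _ (primrec_encodeF_conj _ (hL _ ?_))
  exact primrec_encodeF_strat _ (primrec_encodeF_conj _ (primrec_encodeF_strat _
    (primrec_encodeF_conj _ (primrec_encodeF_undefinedAfter c))))

theorem exists_code_dom_iff_halts : ∃ c : Code, ∀ p : Nat.Partrec.Code,
    (c.eval [2 * Encodable.encode p]).Dom ↔ (p.eval 0).Dom := by
  have hg : Partrec fun m : ℕ => (Denumerable.ofNat Nat.Partrec.Code (m / 2)).eval 0 :=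
    Nat.Partrec.Code.eval_part.comp
      ((Computable.ofNat _).comp (Primrec.nat_div.comp .id (.const 2)).to_comp)
      (Computable.const 0)
  obtain ⟨c, hc⟩ := Code.exists_code (Nat.Partrec'.part_iff₁.2 hg)
  refine ⟨c, fun p => ?_⟩
  have h := hc ⟨[2 * Encodable.encode p], rfl⟩
  change c.eval [2 * Encodable.encode p] = _ at h
  rw [h]
  change ((Denumerable.ofNat Nat.Partrec.Code (2 * Encodable.encode p / 2)).eval 0).Dom ↔ _
  simp

theorem not_exists_computable_satML : ¬ ∃ f : ℕ → Bool, Computable f ∧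
    ∀ φ : Formula, (f (encodeF φ) = true ↔ SatML φ) := by
  rintro ⟨f, hf, H⟩
  obtain ⟨c, hc⟩ := exists_code_dom_iff_halts
  refine ComputablePred.halting_problem 0 (ComputablePred.computable_iff.2
    ⟨fun p => !f (encodeF (game (undefinedAt c (Encodable.encode p)))), ?_, ?_⟩)
  · exact Primrec.not.to_comp.comp (hf.comp
      ((primrec_encodeF_game_undefinedAt c).to_comp.comp Computable.encode))
  · funext p
    have h := (H (game (undefinedAt c (Encodable.encode p)))).trans
      ((satML_game_iff _).trans (undefinedAt_satisfiable_iff c _))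
    rw [hc] at h
    simpa using (not_congr h).symm

end ATLsc

/-- **Theorem.** Satisfiability of ATL_sc with memoryless-strategy quantification over
general (not necessarily turn-based) concurrent game structures is undecidable; this
follows since on one-step formulas (only one `X` modality) memoryless and general
strategy quantification coincide, and the known undecidability proof for ATL_sc
satisfiability over concurrent games uses only such formulas. -/
theorem satisfiability_ATLsc_memoryless_concurrent_undecidable :
    (¬ ∃ f : ℕ → Bool, Computable f ∧
      ∀ φ : Formula, (f (encodeF φ) = true ↔ SatML φ)) ∧
    (∀ (G : CGS) (s : G.State) (φ : Formula), OneStep φ →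
      (StateSatGen G s φ ↔ StateSat G s φ)) := by
  exact ⟨ATLsc.not_exists_computable_satML, fun G s _ hφ =>
    ATLsc.stateSatGen_iff_stateSat_of_oneStep G s hφ⟩
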